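/- Let σ ∈ (0,1) and let k : S¹ → ℝ be a continuous function on the unit circle S¹ of ℝ². Define the symmetric 2×2 matrix L := (1/((1+σ)π)) ∫_{S¹} k(e) ( (3+σ) e ⊗ e − Id₂ ) de, where de is arclength measure on S¹ and Id₂ is the 2×2 identity. Then det L = (1/(2(1+σ)²π²)) ∫_{S¹} ∫_{S¹} k(e) k(ẽ) [ (3+σ)² (1 − (e·ẽ)²) − 2(2+σ) ] de dẽ. (Note 1 − (e·ẽ)² = sin² θ(e,ẽ), with θ(e,ẽ) the angle between e and ẽ; this is the formula for the nonlocal Gaussian curvature K_σ(z) = det L_σ(z) in dimension n = 3, with k(e) the nonlocal directional curvature k_{σ,e}(z).) -/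

import Mathlib

open MeasureTheory Metric Real Filter
open scoped Topology ENNReal InnerProductSpace

/-- The outer product `a ⊗ b` of two vectors in the plane, i.e. the linear map `x ↦ (b·x) a`. -/
noncomputable def outer (a b : EuclideanSpace ℝ (Fin 2)) :
    EuclideanSpace ℝ (Fin 2) →L[ℝ] EuclideanSpace ℝ (Fin 2) :=
  (innerSL ℝ b).smulRight a

/-- The unit circle has finite one-dimensional Hausdorff measure. -/
theorem hausdorffMeasure_unitCircle_lt_top :
    μH[1] (Metric.sphere (0 : EuclideanSpace ℝ (Fin 2)) 1) < ∞ := by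
  let g : ℝ → EuclideanSpace ℝ (Fin 2) := fun t => !₂[cos t, sin t]
  have hg : LipschitzWith 2 g := by
    refine LipschitzWith.of_dist_le_mul fun s t => ?_
    have hc : |cos s - cos t| ≤ |s - t| := by
      simpa [dist_eq] using Real.lipschitzWith_cos.dist_le_mul s t
    have hs : |sin s - sin t| ≤ |s - t| := by
      simpa [dist_eq] using Real.lipschitzWith_sin.dist_le_mul s t
    have hc2 := sq_le_sq.2 (hc.trans_eq (abs_abs _).symm)
    have hs2 := sq_le_sq.2 (hs.trans_eq (abs_abs _).symm)
    rw [EuclideanSpace.dist_eq, Real.dist_eq]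
    refine Real.sqrt_le_iff.2 ⟨by positivity, ?_⟩
    simp only [g, Fin.sum_univ_two, Real.dist_eq, sq_abs, Matrix.cons_val_zero,
      Matrix.cons_val_one, NNReal.coe_ofNat, mul_pow]
    rw [sq_abs] at hc2 hs2
    nlinarith [sq_nonneg (s - t)]
  have hsub : Metric.sphere (0 : EuclideanSpace ℝ (Fin 2)) 1 ⊆ g '' Set.Icc (-π) π := by
    intro e he
    have h1 : e 0 ^ 2 + e 1 ^ 2 = 1 := by
      have h := EuclideanSpace.real_norm_sq_eq e
      rw [mem_sphere_zero_iff_norm.1 he, Fin.sum_univ_two] at h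
      linarith
    let z : ℂ := ⟨e 0, e 1⟩
    have hz : ‖z‖ = 1 := by
      rw [← sq_eq_sq₀ (norm_nonneg _) zero_le_one, Complex.sq_norm, Complex.normSq_apply]
      simp only [z]
      linarith
    refine ⟨z.arg, ⟨(Complex.neg_pi_lt_arg z).le, Complex.arg_le_pi z⟩, ?_⟩
    have hz0 : z ≠ 0 := norm_ne_zero_iff.1 (by simp [hz])
    ext i
    fin_cases i
    · simp [g, Complex.cos_arg hz0, hz, z]
    · simp [g, Complex.sin_arg, hz, z]
  calc
    μH[1] (Metric.sphere (0 : EuclideanSpace ℝ (Fin 2)) 1)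
      ≤ μH[1] (g '' Set.Icc (-π) π) := measure_mono hsub
    _ ≤ (2 : NNReal) ^ (1 : ℝ) * μH[1] (Set.Icc (-π) π) :=
      hg.hausdorffMeasure_image_le zero_le_one _
    _ < ∞ := by
      rw [hausdorffMeasure_real, Real.volume_Icc]
      exact ENNReal.mul_lt_top (by simp) ENNReal.ofReal_lt_top

/-- A continuous function on the unit circle is integrable for the arclength measure. -/
theorem integrableOn_unitCircle {F : Type*} [NormedAddCommGroup F]
    {f : EuclideanSpace ℝ (Fin 2) → F}
    (hf : ContinuousOn f (Metric.sphere (0 : EuclideanSpace ℝ (Fin 2)) 1)) :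
    IntegrableOn f (Metric.sphere (0 : EuclideanSpace ℝ (Fin 2)) 1) μH[1] := by
  have : IsFiniteMeasure (μH[1].restrict (Metric.sphere (0 : EuclideanSpace ℝ (Fin 2)) 1)) :=
    isFiniteMeasure_restrict.2 hausdorffMeasure_unitCircle_lt_top.ne
  have h := hf.integrableOn_compact (μ := μH[1].restrict (Metric.sphere 0 1))
    (isCompact_sphere 0 1)
  rwa [IntegrableOn, Measure.restrict_restrict isClosed_sphere.measurableSet, Set.inter_self] at h

/-- The determinant of an endomorphism of the plane in terms of its standard coordinates. -/
theorem det_euclideanPlane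
    (T : EuclideanSpace ℝ (Fin 2) →L[ℝ] EuclideanSpace ℝ (Fin 2)) :
    LinearMap.det (T : EuclideanSpace ℝ (Fin 2) →ₗ[ℝ] EuclideanSpace ℝ (Fin 2)) =
      T (EuclideanSpace.single 0 1) 0 * T (EuclideanSpace.single 1 1) 1 -
        T (EuclideanSpace.single 1 1) 0 * T (EuclideanSpace.single 0 1) 1 := by
  rw [← LinearMap.det_toMatrix (EuclideanSpace.basisFun (Fin 2) ℝ).toBasis, Matrix.det_fin_two]
  simp [LinearMap.toMatrix_apply]

/-- The determinant of the nonlocal curvature tensor in dimension `n = 3` as a double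
integral over the unit circle (the nonlocal Gaussian curvature formula). -/
theorem det_nonlocal_curvature_tensor (σ : ℝ) (hσ : σ ∈ Set.Ioo 0 1)
    (k : EuclideanSpace ℝ (Fin 2) → ℝ)
    (hk : ContinuousOn k (Metric.sphere (0 : EuclideanSpace ℝ (Fin 2)) 1)) :
    LinearMap.det
        (((1 / ((1 + σ) * π)) •
            ∫ e in Metric.sphere (0 : EuclideanSpace ℝ (Fin 2)) 1,
              k e • ((3 + σ) • outer e e - ContinuousLinearMap.id ℝ (EuclideanSpace ℝ (Fin 2)))
              ∂(μH[1]) :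
          EuclideanSpace ℝ (Fin 2) →L[ℝ] EuclideanSpace ℝ (Fin 2)) :
          EuclideanSpace ℝ (Fin 2) →ₗ[ℝ] EuclideanSpace ℝ (Fin 2)) =
      (1 / (2 * (1 + σ) ^ 2 * π ^ 2)) *
        ∫ e in Metric.sphere (0 : EuclideanSpace ℝ (Fin 2)) 1,
          ∫ f in Metric.sphere (0 : EuclideanSpace ℝ (Fin 2)) 1,
            k e * k f * ((3 + σ) ^ 2 * (1 - ⟪e, f⟫_ℝ ^ 2) - 2 * (2 + σ))
            ∂(μH[1]) ∂(μH[1]) := by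
  have hcoord (i : Fin 2) : Continuous fun e : EuclideanSpace ℝ (Fin 2) => e i := by fun_prop
  have hk0 := integrableOn_unitCircle hk
  have hq (i j : Fin 2) : IntegrableOn (fun e => k e * (e i * e j)) (Metric.sphere 0 1) μH[1] :=
    integrableOn_unitCircle (hk.mul ((hcoord i).mul (hcoord j)).continuousOn)
  have hop : ContinuousOn (fun e => k e • ((3 + σ) • outer e e -
      ContinuousLinearMap.id ℝ (EuclideanSpace ℝ (Fin 2)))) (Metric.sphere 0 1) := by
    have houter : Continuous fun e : EuclideanSpace ℝ (Fin 2) => outer e e :=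
      (ContinuousLinearMap.smulRightL ℝ (EuclideanSpace ℝ (Fin 2))
        (EuclideanSpace ℝ (Fin 2))).continuous₂.comp
        ((innerSL ℝ).continuous.prodMk continuous_id)
    exact hk.smul ((houter.const_smul (3 + σ)).sub continuous_const).continuousOn
  have hopi := integrableOn_unitCircle hop
  set μ : Measure (EuclideanSpace ℝ (Fin 2)) := μH[1].restrict (Metric.sphere 0 1)
  set q : Fin 2 → Fin 2 → ℝ := fun i j => ∫ e, k e * (e i * e j) ∂μ with hqdef
  set K : ℝ := ∫ e, k e ∂μ with hK
  have hsum : K = q 0 0 + q 1 1 := by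
    rw [hqdef]
    dsimp only
    rw [← integral_add (hq 0 0) (hq 1 1)]
    refine setIntegral_congr_fun isClosed_sphere.measurableSet fun e he => ?_
    have h := EuclideanSpace.real_norm_sq_eq e
    rw [mem_sphere_zero_iff_norm.1 he, Fin.sum_univ_two] at h
    linear_combination k e * h
  have hentry (i j : Fin 2) : (∫ e, k e • ((3 + σ) • outer e e -
      ContinuousLinearMap.id ℝ (EuclideanSpace ℝ (Fin 2))) ∂μ) (EuclideanSpace.single j 1) i =
      (3 + σ) * q i j - (if i = j then 1 else 0) * K := by
    rw [ContinuousLinearMap.integral_apply hopi]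
    have h := (EuclideanSpace.proj i : EuclideanSpace ℝ (Fin 2) →L[ℝ] ℝ).integral_comp_comm
      (hopi.apply_continuousLinearMap (EuclideanSpace.single j 1))
    refine (h.symm.trans ?_)
    rw [hqdef, hK]
    dsimp only
    rw [← integral_const_mul, ← integral_const_mul,
      ← integral_sub ((hq i j).const_mul _) (hk0.const_mul _)]
    congr 1
    ext e
    simp [outer, EuclideanSpace.inner_single_right]
    split_ifs <;> ring
  have hlin (a b c d : ℝ) : ∫ f, (a * k f - b * (k f * (f 0 * f 0)) - c * (k f * (f 0 * f 1))
      - d * (k f * (f 1 * f 1))) ∂μ = a * K - b * q 0 0 - c * q 0 1 - d * q 1 1 := by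
    have h1 : Integrable (fun f => a * k f) μ := hk0.const_mul a
    have h2 : Integrable (fun f => a * k f - b * (k f * (f 0 * f 0))) μ :=
      h1.sub ((hq 0 0).const_mul b)
    have h3 : Integrable (fun f => a * k f - b * (k f * (f 0 * f 0)) - c * (k f * (f 0 * f 1))) μ :=
      h2.sub ((hq 0 1).const_mul c)
    rw [integral_sub h3 ((hq 1 1).const_mul d), integral_sub h2 ((hq 0 1).const_mul c),
      integral_sub h1 ((hq 0 0).const_mul b)]
    simp only [integral_const_mul, hqdef, hK]
  have hinner (e : EuclideanSpace ℝ (Fin 2)) :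
      ∫ f, k e * k f * ((3 + σ) ^ 2 * (1 - ⟪e, f⟫_ℝ ^ 2) - 2 * (2 + σ)) ∂μ =
        ((3 + σ) ^ 2 - 2 * (2 + σ)) * K * k e - (3 + σ) ^ 2 * q 0 0 * (k e * (e 0 * e 0))
          - 2 * (3 + σ) ^ 2 * q 0 1 * (k e * (e 0 * e 1))
          - (3 + σ) ^ 2 * q 1 1 * (k e * (e 1 * e 1)) := by
    have h : ∀ f, k e * k f * ((3 + σ) ^ 2 * (1 - ⟪e, f⟫_ℝ ^ 2) - 2 * (2 + σ)) =
        ((3 + σ) ^ 2 - 2 * (2 + σ)) * k e * k f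
          - (3 + σ) ^ 2 * (k e * (e 0 * e 0)) * (k f * (f 0 * f 0))
          - 2 * (3 + σ) ^ 2 * (k e * (e 0 * e 1)) * (k f * (f 0 * f 1))
          - (3 + σ) ^ 2 * (k e * (e 1 * e 1)) * (k f * (f 1 * f 1)) := by
      intro f
      simp only [PiLp.inner_apply, Fin.sum_univ_two, RCLike.inner_apply, conj_trivial]
      ring
    simp_rw [h]
    rw [hlin]
    ring
  have hdouble : ∫ e, ∫ f, k e * k f * ((3 + σ) ^ 2 * (1 - ⟪e, f⟫_ℝ ^ 2) - 2 * (2 + σ)) ∂μ ∂μ =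
      ((3 + σ) ^ 2 - 2 * (2 + σ)) * K * K - (3 + σ) ^ 2 * q 0 0 * q 0 0
        - 2 * (3 + σ) ^ 2 * q 0 1 * q 0 1 - (3 + σ) ^ 2 * q 1 1 * q 1 1 := by
    simp_rw [hinner, hlin]
  have hsymm : q 1 0 = q 0 1 := by
    simp only [hqdef, mul_comm]
  have hσ1 : 1 + σ ≠ 0 := by linarith [hσ.1]
  rw [hdouble, det_euclideanPlane]
  simp only [_root_.smul_apply, PiLp.smul_apply, smul_eq_mul, hentry, hsymm, hsum]
  simp only [if_true, Fin.isValue, zero_ne_one, one_ne_zero, if_false]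
  field_simp
  ring
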